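/- arXiv:2602.06756 — 2 statements merged into one kernel-verified Lean document; each statement's English description precedes it below -/
import Mathlib

section
/- Let P₁, Q₁ be mutually absolutely continuous probability measures on a measurable space Ω₁ with r = dQ₁/dP₁. Let ((P₂ⁿ, Q₂ⁿ))_{n∈ℕ} be a countable family of pairs of mutually absolutely continuous probability measures on a measurable space Ω₂, and let H^↑(γ) = sup_{n∈ℕ} D_γ(P₂ⁿ ‖ Q₂ⁿ). Then for every γ ≥ 0 and every η > 0 there exist Markov kernels κ_P, κ_Q from Ω₁ to Ω₂ such that for every y₁ ∈ Ω₁ there is an index n(y₁) with κ_P(y₁) = P₂^{n(y₁)} and κ_Q(y₁) = Q₂^{n(y₁)}, and ∫_{Ω₁} H^↑(γ · r(y₁)) dP₁(y₁) − η ≤ D_γ(P₁ ⊗ κ_P ‖ Q₁ ⊗ κ_Q) ≤ ∫_{Ω₁} H^↑(γ · r(y₁)) dP₁(y₁). In other words, the adaptive-composition bound given by the pointwise supremum of the available privacy profiles cannot be improved at any order γ. -/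
open MeasureTheory ProbabilityTheory

/-- The hockey-stick divergence of order `γ ≥ 0` of `P` from `Q`, computed with the
dominating measure `P + Q`:  `D_γ(P‖Q) = ∫ max(p − γ·q, 0) d(P+Q)` where `p, q` are the
densities of `P, Q` w.r.t. `P + Q`. (The value does not depend on the choice of
dominating measure.) -/
noncomputable def hockeyStick {Ω : Type*} [MeasurableSpace Ω] (γ : ℝ)
    (P Q : Measure Ω) : ℝ :=
  ∫ y, max ((P.rnDeriv (P + Q) y).toReal - γ * (Q.rnDeriv (P + Q) y).toReal) 0 ∂(P + Q)

theorem hs_eq {Ω : Type*} [MeasurableSpace Ω] (γ : ℝ) (P Q : Measure Ω)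
    [IsFiniteMeasure P] [IsFiniteMeasure Q] (h : Q ≪ P) (f : Ω → ENNReal)
    (hf : Q.rnDeriv P =ᵐ[P] f) :
    hockeyStick γ P Q = ∫ y, max (1 - γ * (f y).toReal) 0 ∂P := by
  have hP : P ≪ P + Q := Measure.AbsolutelyContinuous.rfl.add_right Q
  have hP' : P + Q ≪ P := Measure.AbsolutelyContinuous.add_left Measure.AbsolutelyContinuous.rfl h
  rw [← integral_rnDeriv_smul (μ := P) (ν := P + Q) hP]
  unfold hockeyStick
  apply integral_congr_ae
  filter_upwards [Measure.rnDeriv_mul_rnDeriv (κ := P + Q) h, hP'.ae_le hf] with y h1 h2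
  rw [← h1, ← h2]
  simp only [Pi.mul_apply, ENNReal.toReal_mul, smul_eq_mul]
  rw [mul_max_of_nonneg _ _ ENNReal.toReal_nonneg]
  congr 1 <;> ring

theorem hs_meas {Ω₁ Ω₂ : Type*} [MeasurableSpace Ω₁] [MeasurableSpace Ω₂]
    (P Q : Measure Ω₂) [IsFiniteMeasure P] [IsFiniteMeasure Q] (h : Q ≪ P)
    (g : Ω₁ → ℝ) (hg : Measurable g) :
    Measurable fun y => hockeyStick (g y) P Q := by
  simp_rw [hs_eq _ P Q h _ (Filter.EventuallyEq.refl _ _)]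
  apply StronglyMeasurable.measurable
  apply StronglyMeasurable.integral_prod_right
  apply Measurable.stronglyMeasurable
  have := Measure.measurable_rnDeriv Q P
  fun_prop

theorem hs_nonneg {Ω : Type*} [MeasurableSpace Ω] (γ : ℝ) (P Q : Measure Ω) :
    0 ≤ hockeyStick γ P Q := integral_nonneg fun _ => le_max_right _ _

theorem aux_int {Ω : Type*} [MeasurableSpace Ω] {γ : ℝ} (hγ : 0 ≤ γ) (P : Measure Ω)
    [IsFiniteMeasure P] (f : Ω → ENNReal) (hf : Measurable f) :
    Integrable (fun y => max (1 - γ * (f y).toReal) 0) P := by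
  apply Integrable.of_bound (C := 1)
  · apply Measurable.aestronglyMeasurable
    fun_prop
  · refine Filter.Eventually.of_forall fun y => ?_
    have : 0 ≤ γ * (f y).toReal := by positivity
    rw [Real.norm_of_nonneg (le_max_right _ _)]
    exact max_le (by linarith) zero_le_one

theorem hs_le_one {Ω : Type*} [MeasurableSpace Ω] {γ : ℝ} (hγ : 0 ≤ γ) (P Q : Measure Ω)
    [IsProbabilityMeasure P] [IsProbabilityMeasure Q] (h : Q ≪ P) :
    hockeyStick γ P Q ≤ 1 := by
  rw [hs_eq _ P Q h _ (Filter.EventuallyEq.refl _ _)]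
  calc _ ≤ ∫ y, (1 : ℝ) ∂P := by
        apply integral_mono (aux_int hγ P _ (Measure.measurable_rnDeriv Q P))
          (integrable_const _)
        intro y
        have : 0 ≤ γ * (Q.rnDeriv P y).toReal := by positivity
        exact max_le (by linarith) zero_le_one
    _ = 1 := by simp

theorem hs_comp {Ω₁ Ω₂ : Type*} [MeasurableSpace Ω₁] [MeasurableSpace Ω₂]
    (P₁ Q₁ : Measure Ω₁) [IsProbabilityMeasure P₁] [IsProbabilityMeasure Q₁]
    (hQP : Q₁ ≪ P₁)
    (P₂ Q₂ : ℕ → Measure Ω₂)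
    [∀ n, IsProbabilityMeasure (P₂ n)] [∀ n, IsProbabilityMeasure (Q₂ n)]
    (hac : ∀ n, Q₂ n ≪ P₂ n) (γ : ℝ) (hγ : 0 ≤ γ) (N : Ω₁ → ℕ) (hN : Measurable N)
    (κP κQ : Kernel Ω₁ Ω₂) [IsMarkovKernel κP] [IsMarkovKernel κQ]
    (hp : ∀ y, κP y = P₂ (N y)) (hq : ∀ y, κQ y = Q₂ (N y)) :
    hockeyStick γ (P₁ ⊗ₘ κP) (Q₁ ⊗ₘ κQ) =
      ∫ y, hockeyStick (γ * (Q₁.rnDeriv P₁ y).toReal) (P₂ (N y)) (Q₂ (N y)) ∂P₁ := by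
  have hr := Measure.measurable_rnDeriv Q₁ P₁
  set F : Ω₁ × Ω₂ → ENNReal := fun z => (Q₂ (N z.1)).rnDeriv (P₂ (N z.1)) z.2 with hF
  have hFm : Measurable F := by
    have : Measurable (Function.uncurry fun (n : ℕ) (z : Ω₂) => (Q₂ n).rnDeriv (P₂ n) z) :=
      measurable_from_prod_countable_right fun n => Measure.measurable_rnDeriv (Q₂ n) (P₂ n)
    exact this.comp ((hN.comp measurable_fst).prodMk measurable_snd)
  set G : Ω₁ × Ω₂ → ENNReal := fun z => Q₁.rnDeriv P₁ z.1 * F z with hG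
  have hGm : Measurable G := (hr.comp measurable_fst).mul hFm
  have key : Q₁ ⊗ₘ κQ = (P₁ ⊗ₘ κP).withDensity G := by
    ext s hs
    have hm : Measurable fun y => κQ y (Prod.mk y ⁻¹' s) := Kernel.measurable_kernel_prodMk_left hs
    rw [withDensity_apply _ hs, Measure.compProd_apply hs, ← lintegral_indicator hs,
      Measure.lintegral_compProd (hGm.indicator hs), ← lintegral_rnDeriv_mul hQP hm.aemeasurable]
    congr 1
    ext y
    have hs' : MeasurableSet (Prod.mk y ⁻¹' s) := measurable_prodMk_left hs
    have e : ∀ z, s.indicator G (y, z) = Q₁.rnDeriv P₁ y *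
        (Prod.mk y ⁻¹' s).indicator ((Q₂ (N y)).rnDeriv (P₂ (N y))) z := by
      intro z
      by_cases hz : (y, z) ∈ s <;> simp [Set.indicator, hz, hG, hF]
    simp_rw [e]
    rw [lintegral_const_mul _ ((Measure.measurable_rnDeriv _ _).indicator hs'),
      lintegral_indicator hs', hp, hq, Measure.setLIntegral_rnDeriv (hac _)]
  have hd : (Q₁ ⊗ₘ κQ).rnDeriv (P₁ ⊗ₘ κP) =ᵐ[P₁ ⊗ₘ κP] G := by
    rw [key]
    exact Measure.rnDeriv_withDensity _ hGm
  have hacc : (Q₁ ⊗ₘ κQ) ≪ (P₁ ⊗ₘ κP) := by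
    rw [key]
    exact withDensity_absolutelyContinuous _ _
  rw [hs_eq γ _ _ hacc G hd, Measure.integral_compProd (aux_int hγ _ G hGm)]
  congr 1
  ext y
  rw [hs_eq _ _ _ (hac (N y)) _ (Filter.EventuallyEq.refl _ _), hp]
  simp [hG, hF, ENNReal.toReal_mul, mul_assoc]

/-- **Tightness of the adaptive composition bound (Theorem: the standard adaptive
composition guarantee cannot be improved).** Let `P₁, Q₁` be mutually absolutely
continuous probability measures with `r = dQ₁/dP₁`, and let `((P₂ n, Q₂ n))_{n ∈ ℕ}` be
a countable family of pairs of mutually absolutely continuous probability measures on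
`Ω₂`, with `H^↑(γ) = ⨆ n, D_γ(P₂ n ‖ Q₂ n)`.  Then for every `γ ≥ 0` and `η > 0` there
are Markov kernels `κP, κQ`, each choosing at every `y₁` one of the available pairs,
whose adaptive composition satisfies
`∫ H^↑(γ·r(y₁)) dP₁ − η ≤ D_γ(P₁ ⊗ κP ‖ Q₁ ⊗ κQ) ≤ ∫ H^↑(γ·r(y₁)) dP₁`. -/
theorem adaptive_composition_bound_tight
    {Ω₁ Ω₂ : Type*} [MeasurableSpace Ω₁] [MeasurableSpace Ω₂]
    (P₁ Q₁ : Measure Ω₁) [IsProbabilityMeasure P₁] [IsProbabilityMeasure Q₁]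
    (hPQ : P₁ ≪ Q₁) (hQP : Q₁ ≪ P₁)
    (P₂ Q₂ : ℕ → Measure Ω₂)
    [∀ n, IsProbabilityMeasure (P₂ n)] [∀ n, IsProbabilityMeasure (Q₂ n)]
    (hac : ∀ n, P₂ n ≪ Q₂ n ∧ Q₂ n ≪ P₂ n) :
    ∀ γ ≥ (0 : ℝ), ∀ η > (0 : ℝ),
      ∃ κP κQ : Kernel Ω₁ Ω₂, IsMarkovKernel κP ∧ IsMarkovKernel κQ ∧
        (∀ y₁, ∃ n, κP y₁ = P₂ n ∧ κQ y₁ = Q₂ n) ∧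
        (∫ y₁, (⨆ n, hockeyStick (γ * (Q₁.rnDeriv P₁ y₁).toReal) (P₂ n) (Q₂ n)) ∂P₁) - η
            ≤ hockeyStick γ (P₁ ⊗ₘ κP) (Q₁ ⊗ₘ κQ) ∧
        hockeyStick γ (P₁ ⊗ₘ κP) (Q₁ ⊗ₘ κQ)
            ≤ ∫ y₁, (⨆ n, hockeyStick (γ * (Q₁.rnDeriv P₁ y₁).toReal) (P₂ n) (Q₂ n)) ∂P₁ := by
  intro γ hγ η hη
  set H : ℕ → Ω₁ → ℝ := fun n y =>
    hockeyStick (γ * (Q₁.rnDeriv P₁ y).toReal) (P₂ n) (Q₂ n) with hH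
  have hg0 : ∀ y, 0 ≤ γ * (Q₁.rnDeriv P₁ y).toReal := fun y => by positivity
  have hgm : Measurable fun y => γ * (Q₁.rnDeriv P₁ y).toReal := by
    have := Measure.measurable_rnDeriv Q₁ P₁
    fun_prop
  have hHm : ∀ n, Measurable (H n) := fun n => hs_meas _ _ (hac n).2 _ hgm
  have hH1 : ∀ n y, H n y ≤ 1 := fun n y => hs_le_one (hg0 y) _ _ (hac n).2
  have hH0 : ∀ n y, 0 ≤ H n y := fun n y => hs_nonneg _ _ _
  have hbdd : ∀ y, BddAbove (Set.range fun n => H n y) := fun y =>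
    ⟨1, by rintro _ ⟨n, rfl⟩; exact hH1 n y⟩
  have hSm : Measurable fun y => ⨆ n, H n y := Measurable.iSup hHm
  have hex : ∀ y, ∃ n, (⨆ n, H n y) - η < H n y := fun y =>
    exists_lt_of_lt_ciSup (by linarith)
  classical
  set N : Ω₁ → ℕ := fun y => Nat.find (hex y) with hNdef
  have hN : Measurable N := measurable_find hex fun n =>
    measurableSet_lt (hSm.sub_const η) (hHm n)
  have hNs : ∀ y, (⨆ n, H n y) - η < H (N y) y := fun y => Nat.find_spec (hex y)
  let κP : Kernel Ω₁ Ω₂ := ⟨fun y => P₂ (N y), (measurable_from_nat (f := P₂)).comp hN⟩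
  let κQ : Kernel Ω₁ Ω₂ := ⟨fun y => Q₂ (N y), (measurable_from_nat (f := Q₂)).comp hN⟩
  have hp : ∀ y, κP y = P₂ (N y) := fun y => rfl
  have hq : ∀ y, κQ y = Q₂ (N y) := fun y => rfl
  have : IsMarkovKernel κP := ⟨fun y => by rw [hp]; infer_instance⟩
  have : IsMarkovKernel κQ := ⟨fun y => by rw [hq]; infer_instance⟩
  have hc := hs_comp P₁ Q₁ hQP P₂ Q₂ (fun n => (hac n).2) γ hγ N hN κP κQ hp hq
  have hSi : Integrable (fun y => ⨆ n, H n y) P₁ := by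
    refine Integrable.of_bound hSm.aestronglyMeasurable 1 (Filter.Eventually.of_forall fun y => ?_)
    rw [Real.norm_of_nonneg (Real.iSup_nonneg fun n => hH0 n y)]
    exact ciSup_le fun n => hH1 n y
  have hNm : Measurable fun y => H (N y) y := by
    have : Measurable (Function.uncurry H) := measurable_from_prod_countable_right hHm
    exact this.comp (hN.prodMk measurable_id)
  have hNi : Integrable (fun y => H (N y) y) P₁ := by
    refine Integrable.of_bound hNm.aestronglyMeasurable 1 (Filter.Eventually.of_forall fun y => ?_)
    rw [Real.norm_of_nonneg (hH0 _ _)]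
    exact hH1 _ _
  refine ⟨κP, κQ, inferInstance, inferInstance, fun y => ⟨N y, hp y, hq y⟩, ?_, ?_⟩
  · rw [hc]
    have h1 : (∫ y, (⨆ n, H n y) ∂P₁) - η = ∫ y, ((⨆ n, H n y) - η) ∂P₁ := by
      rw [integral_sub hSi (integrable_const _)]
      simp
    exact h1.le.trans (integral_mono (hSi.sub (integrable_const _)) hNi fun y => (hNs y).le)
  · rw [hc]
    exact integral_mono hNi hSi fun y => le_ciSup (hbdd y) (N y)
end

section
/- There exist constants C > 0 and q₀ ∈ (0,1), depending on n, σ and h, such that for all q ∈ (0, q₀]: E_{P_q}[ |L_q − E_{P_q}[L_q]|³ ] ≤ q³·(e^{3μ²/σ²} + 3e^{μ²/σ²} + 1) + C·q⁴, and likewise E_{Q_q}[ |L_q − E_{Q_q}[L_q]|³ ] ≤ q³·(e^{3μ²/σ²} + 3e^{μ²/σ²} + 1) + C·q⁴. -/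
open MeasureTheory ProbabilityTheory

/-- The Poisson-subsampled Gaussian output distribution on the dataset `S = {0,…,n}`:
`P_q = Σ_{J ⊆ {0,…,n}} q^{|J|} (1−q)^{n+1−|J|} · N(h(J), σ²)`. -/
noncomputable def subsampledP (n : ℕ) (σ q : ℝ) (h : Finset ℕ → ℝ) : Measure ℝ :=
  ∑ J ∈ (Finset.range (n + 1)).powerset,
    ENNReal.ofReal (q ^ J.card * (1 - q) ^ (n + 1 - J.card)) •
      gaussianReal (h J) (σ ^ 2).toNNReal

/-- The Poisson-subsampled Gaussian output distribution on the dataset `S⁻ = {0,…,n−1}`: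
`Q_q = Σ_{J ⊆ {0,…,n−1}} q^{|J|} (1−q)^{n−|J|} · N(h(J), σ²)`. -/
noncomputable def subsampledQ (n : ℕ) (σ q : ℝ) (h : Finset ℕ → ℝ) : Measure ℝ :=
  ∑ J ∈ (Finset.range n).powerset,
    ENNReal.ofReal (q ^ J.card * (1 - q) ^ (n - J.card)) •
      gaussianReal (h J) (σ ^ 2).toNNReal

/-- The privacy loss `L_q = ln(dP_q/dQ_q)` of the Poisson-subsampled Gaussian
mechanism. -/
noncomputable def privacyLoss (n : ℕ) (σ q : ℝ) (h : Finset ℕ → ℝ) (y : ℝ) : ℝ :=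
  Real.log (((subsampledP n σ q h).rnDeriv (subsampledQ n σ q h) y).toReal)

open Filter Topology

noncomputable def sgMix (m : ℕ) (q : ℝ) (f : Finset ℕ → ℝ) : ℝ :=
  ∑ J ∈ (Finset.range m).powerset, q ^ J.card * (1 - q) ^ (m - J.card) * f J

noncomputable def sgE (σ : ℝ) (h : Finset ℕ → ℝ) (J : Finset ℕ) (y : ℝ) : ℝ :=
  Real.exp (h J / σ ^ 2 * y - h J ^ 2 / (2 * σ ^ 2))

lemma sgMix_succ (m : ℕ) (q : ℝ) (f : Finset ℕ → ℝ) :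
    sgMix (m + 1) q f = (1 - q) * sgMix m q f + q * sgMix m q (fun J => f (insert m J)) := by
  unfold sgMix
  rw [Finset.range_add_one, Finset.sum_powerset_insert (by simp), Finset.mul_sum, Finset.mul_sum]
  congr 1
  · refine Finset.sum_congr rfl fun J hJ => ?_
    have hc : J.card ≤ m := by simpa using Finset.card_le_card (Finset.mem_powerset.1 hJ)
    rw [Nat.succ_sub hc, pow_succ]; ring
  · refine Finset.sum_congr rfl fun J hJ => ?_
    have hm : m ∉ J := fun hh => by simpa using Finset.mem_powerset.1 hJ hh
    rw [Finset.card_insert_of_notMem hm, Nat.add_sub_add_right, pow_succ]; ring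

lemma sgMix_zero (m : ℕ) (f : Finset ℕ → ℝ) : sgMix m 0 f = f ∅ := by
  induction m generalizing f with
  | zero => simp [sgMix]
  | succ k ih => rw [sgMix_succ, ih]; simp

lemma sgMix_continuous (m : ℕ) (f : Finset ℕ → ℝ) : Continuous (fun q => sgMix m q f) := by
  unfold sgMix; fun_prop

lemma sgMix_le (m : ℕ) (q : ℝ) (hq : 0 ≤ q) (hq1 : q ≤ 1) (B : ℝ) (f : Finset ℕ → ℝ)
    (hf : ∀ J ⊆ Finset.range m, f J ≤ B) : sgMix m q f ≤ B := by
  induction m generalizing f with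
  | zero => simpa [sgMix] using hf ∅ (by simp)
  | succ k ih =>
    rw [sgMix_succ]
    have h1 := ih f fun J hJ => hf J (hJ.trans (Finset.range_mono (Nat.le_succ k)))
    have h2 := ih (fun J => f (insert k J)) fun J hJ => hf _ (by
      rw [Finset.range_add_one]; exact Finset.insert_subset_insert _ hJ)
    nlinarith

lemma sgMix_nonneg (m : ℕ) (q : ℝ) (hq : 0 ≤ q) (hq1 : q ≤ 1) (f : Finset ℕ → ℝ)
    (hf : ∀ J, 0 ≤ f J) : 0 ≤ sgMix m q f := by
  have : 0 ≤ 1 - q := by linarith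
  exact Finset.sum_nonneg fun J _ => mul_nonneg (by positivity) (hf J)

lemma le_sgMix (m : ℕ) (q : ℝ) (hq : 0 ≤ q) (hq1 : q ≤ 1) (f : Finset ℕ → ℝ)
    (hf : ∀ J, 0 ≤ f J) : (1 - q) ^ m * f ∅ ≤ sgMix m q f := by
  have : 0 ≤ 1 - q := by linarith
  have := Finset.single_le_sum
    (f := fun J : Finset ℕ => q ^ J.card * (1 - q) ^ (m - J.card) * f J)
    (s := (Finset.range m).powerset)
    (fun J _ => mul_nonneg (by positivity) (hf J)) (Finset.empty_mem_powerset _)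
  simpa [sgMix] using this

lemma sgE_gaussian (σ : ℝ) (hσ : 0 < σ) (h : Finset ℕ → ℝ) (J : Finset ℕ) :
    gaussianReal (h J) (σ ^ 2).toNNReal =
      (gaussianReal 0 (σ ^ 2).toNNReal).withDensity (fun y => ENNReal.ofReal (sgE σ h J y)) := by
  have hv : (σ ^ 2).toNNReal ≠ 0 := by
    simp only [ne_eq, Real.toNNReal_eq_zero, not_le]; positivity
  rw [gaussianReal_of_var_ne_zero _ hv, gaussianReal_of_var_ne_zero _ hv,
    ← withDensity_mul _ (by fun_prop) (by unfold sgE; fun_prop)]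
  congr 1
  ext y
  simp only [gaussianPDF, Pi.mul_apply]
  rw [← ENNReal.ofReal_mul (gaussianPDFReal_nonneg _ _ _)]
  congr 1
  simp only [gaussianPDFReal, sgE]
  rw [mul_assoc (_)⁻¹, ← Real.exp_add, Real.coe_toNNReal _ (by positivity)]
  congr 2
  field_simp
  ring

lemma sgE_meas (σ : ℝ) (h : Finset ℕ → ℝ) (J : Finset ℕ) : Measurable (sgE σ h J) := by
  unfold sgE; fun_prop

lemma sgMix_meas (m : ℕ) (σ q : ℝ) (h : Finset ℕ → ℝ) :
    Measurable (fun y => sgMix m q (fun J => sgE σ h J y)) := by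
  unfold sgMix sgE; fun_prop

lemma subQ_eq (m : ℕ) (σ q : ℝ) (hσ : 0 < σ) (hq : 0 ≤ q) (hq1 : q ≤ 1) (h : Finset ℕ → ℝ) :
    subsampledQ m σ q h = (gaussianReal 0 (σ ^ 2).toNNReal).withDensity
      (fun y => ENNReal.ofReal (sgMix m q (fun J => sgE σ h J y))) := by
  have hq' : 0 ≤ 1 - q := by linarith
  ext s hs
  unfold subsampledQ
  rw [withDensity_apply _ hs]
  simp only [Measure.coe_finsetSum, Finset.sum_apply, Measure.smul_apply, smul_eq_mul, sgMix]
  have : ∀ y, ENNReal.ofReal (∑ J ∈ (Finset.range m).powerset,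
      q ^ J.card * (1 - q) ^ (m - J.card) * sgE σ h J y) =
      ∑ J ∈ (Finset.range m).powerset, ENNReal.ofReal (q ^ J.card * (1 - q) ^ (m - J.card)) *
        ENNReal.ofReal (sgE σ h J y) := by
    intro y
    rw [ENNReal.ofReal_sum_of_nonneg]
    · refine Finset.sum_congr rfl fun J _ => ?_
      rw [ENNReal.ofReal_mul (by positivity)]
    · intro J _
      have := (Real.exp_pos (h J / σ ^ 2 * y - h J ^ 2 / (2 * σ ^ 2))).le
      unfold sgE; positivity
  simp only [this]
  rw [lintegral_finsetSum]
  · refine Finset.sum_congr rfl fun J _ => ?_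
    rw [lintegral_const_mul _ (sgE_meas σ h J).ennreal_ofReal, sgE_gaussian σ hσ h J,
      withDensity_apply _ hs]
  · intro J _
    exact ((sgE_meas σ h J).ennreal_ofReal).const_mul _

lemma subP_eq (n : ℕ) (σ q : ℝ) (h : Finset ℕ → ℝ) :
    subsampledP n σ q h = subsampledQ (n + 1) σ q h := rfl

lemma sgMix_pos (m : ℕ) (σ q : ℝ) (hq : 0 ≤ q) (hq1 : q < 1) (h : Finset ℕ → ℝ) (y : ℝ) :
    0 < sgMix m q (fun J => sgE σ h J y) := by
  have h1 : 0 < 1 - q := by linarith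
  refine lt_of_lt_of_le ?_ (le_sgMix m q hq hq1.le _ fun J => (Real.exp_pos _).le)
  exact mul_pos (by positivity) (Real.exp_pos _)

/-- scaled explicit privacy loss -/
noncomputable def sgL (n : ℕ) (σ : ℝ) (h : Finset ℕ → ℝ) (q y : ℝ) : ℝ :=
  Real.log (sgMix (n + 1) q (fun J => sgE σ h J y) / sgMix n q (fun J => sgE σ h J y)) / q

instance subQ_prob_fin (m : ℕ) (σ q : ℝ) (h : Finset ℕ → ℝ) :
    IsFiniteMeasure (subsampledQ m σ q h) := by
  constructor
  unfold subsampledQ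
  simp only [Measure.coe_finsetSum, Finset.sum_apply, Measure.smul_apply, smul_eq_mul,
    measure_univ, mul_one]
  exact ENNReal.sum_lt_top.2 fun _ _ => ENNReal.ofReal_lt_top

lemma privacyLoss_ae (n : ℕ) (σ q : ℝ) (hσ : 0 < σ) (hq : 0 < q) (hq1 : q < 1)
    (h : Finset ℕ → ℝ) (m : ℕ) :
    ∀ᵐ y ∂(subsampledQ m σ q h), privacyLoss n σ q h y = q * sgL n σ h q y := by
  have hmQ := sgMix_meas n σ q h
  have hmP := sgMix_meas (n + 1) σ q h
  have hmD : Measurable (fun y => ENNReal.ofReal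
      (sgMix (n + 1) q (fun J => sgE σ h J y) / sgMix n q (fun J => sgE σ h J y))) :=
    (hmP.div hmQ).ennreal_ofReal
  have hac : gaussianReal 0 (σ ^ 2).toNNReal ≪ subsampledQ n σ q h := by
    rw [subQ_eq n σ q hσ hq.le hq1.le h]
    refine withDensity_absolutelyContinuous' hmQ.ennreal_ofReal.aemeasurable (ae_of_all _ ?_)
    intro y
    simpa using sgMix_pos n σ q hq.le hq1 h y
  have hac2 : subsampledQ m σ q h ≪ subsampledQ n σ q h := by
    refine Measure.AbsolutelyContinuous.trans ?_ hac
    rw [subQ_eq m σ q hσ hq.le hq1.le h]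
    exact withDensity_absolutelyContinuous _ _
  have hP : subsampledP n σ q h = (subsampledQ n σ q h).withDensity (fun y => ENNReal.ofReal
      (sgMix (n + 1) q (fun J => sgE σ h J y) / sgMix n q (fun J => sgE σ h J y))) := by
    rw [subP_eq, subQ_eq (n+1) σ q hσ hq.le hq1.le h, subQ_eq n σ q hσ hq.le hq1.le h,
      ← withDensity_mul _ hmQ.ennreal_ofReal hmD]
    congr 1
    ext y
    have := sgMix_pos n σ q hq.le hq1 h y
    simp only [Pi.mul_apply]
    rw [← ENNReal.ofReal_mul this.le, mul_div_cancel₀ _ this.ne']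
  refine hac2.ae_le ?_
  have := Measure.rnDeriv_withDensity (subsampledQ n σ q h) hmD
  rw [← hP] at this
  filter_upwards [this] with y hy
  have p1 := sgMix_pos n σ q hq.le hq1 h y
  have p2 := sgMix_pos (n+1) σ q hq.le hq1 h y
  unfold privacyLoss sgL
  rw [hy]
  rw [ENNReal.toReal_ofReal (by positivity), mul_div_cancel₀ _ hq.ne']

lemma integral_subQ (m : ℕ) (σ q : ℝ) (hσ : 0 < σ) (hq : 0 ≤ q) (hq1 : q < 1)
    (h : Finset ℕ → ℝ) (g : ℝ → ℝ) :
    ∫ y, g y ∂(subsampledQ m σ q h) =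
      ∫ y, sgMix m q (fun J => sgE σ h J y) * g y ∂(gaussianReal 0 (σ ^ 2).toNNReal) := by
  rw [subQ_eq m σ q hσ hq hq1.le h, integral_withDensity_eq_integral_toReal_smul
    (sgMix_meas m σ q h).ennreal_ofReal (ae_of_all _ fun _ => ENNReal.ofReal_lt_top)]
  refine integral_congr_ae (ae_of_all _ fun y => ?_)
  simp only [smul_eq_mul]
  rw [ENNReal.toReal_ofReal (sgMix_pos m σ q hq hq1 h y).le]

lemma moment_eq (n m : ℕ) (σ q : ℝ) (hσ : 0 < σ) (hq : 0 < q) (hq1 : q < 1)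
    (h : Finset ℕ → ℝ) :
    (∫ y, |privacyLoss n σ q h y -
      ∫ z, privacyLoss n σ q h z ∂(subsampledQ m σ q h)| ^ 3 ∂(subsampledQ m σ q h)) =
    q ^ 3 * ∫ y, sgMix m q (fun J => sgE σ h J y) * |sgL n σ h q y -
      ∫ z, sgMix m q (fun J => sgE σ h J z) * sgL n σ h q z ∂(gaussianReal 0 (σ ^ 2).toNNReal)| ^ 3
        ∂(gaussianReal 0 (σ ^ 2).toNNReal) := by
  have hae := privacyLoss_ae n σ q hσ hq hq1 h m
  have h1 : ∫ z, privacyLoss n σ q h z ∂(subsampledQ m σ q h) =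
      q * ∫ z, sgMix m q (fun J => sgE σ h J z) * sgL n σ h q z
        ∂(gaussianReal 0 (σ ^ 2).toNNReal) := by
    rw [integral_congr_ae hae, integral_const_mul, integral_subQ m σ q hσ hq.le hq1 h]
  rw [h1]
  generalize ∫ z, sgMix m q (fun J => sgE σ h J z) * sgL n σ h q z
        ∂(gaussianReal 0 (σ ^ 2).toNNReal) = c
  rw [← integral_subQ m σ q hσ hq.le hq1 h (fun y => |sgL n σ h q y - c| ^ 3),
    ← integral_const_mul (q ^ 3)]
  refine integral_congr_ae ?_
  filter_upwards [hae] with y hy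
  rw [hy, ← mul_sub, abs_mul, abs_of_pos hq, mul_pow]

lemma sgLim {γ : Measure ℝ} [IsProbabilityMeasure γ] (p l : ℝ → ℝ → ℝ) (E l0 : ℝ → ℝ) (K : ℝ)
    (hE1 : ∀ y, 1 ≤ E y) (hE : Integrable (fun y => E y ^ 4) γ) (hK : 0 ≤ K)
    (hpm : ∀ q, Measurable (p q)) (hlm : ∀ q, Measurable (l q))
    (hp : ∀ᶠ q in 𝓝[>] (0:ℝ), ∀ y, |p q y| ≤ E y)
    (hl : ∀ᶠ q in 𝓝[>] (0:ℝ), ∀ y, |l q y| ≤ K * E y)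
    (hpt : ∀ y, Tendsto (fun q => p q y) (𝓝[>] 0) (𝓝 1))
    (hlt : ∀ y, Tendsto (fun q => l q y) (𝓝[>] 0) (𝓝 (l0 y))) :
    Tendsto (fun q => ∫ y, p q y * |l q y - ∫ z, p q z * l q z ∂γ| ^ 3 ∂γ) (𝓝[>] 0)
      (𝓝 (∫ y, |l0 y - ∫ z, l0 z ∂γ| ^ 3 ∂γ)) := by
  have hI1 : Tendsto (fun q => ∫ z, p q z * l q z ∂γ) (𝓝[>] 0) (𝓝 (∫ z, l0 z ∂γ)) := by
    refine tendsto_integral_filter_of_dominated_convergence (fun y => K * E y ^ 4) ?_ ?_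
      (hE.const_mul K) (ae_of_all _ fun y => ?_)
    · exact Eventually.of_forall fun q => ((hpm q).mul (hlm q)).aestronglyMeasurable
    · filter_upwards [hp, hl] with q h1 h2
      refine ae_of_all _ fun y => ?_
      rw [Real.norm_eq_abs, abs_mul]
      have hy := hE1 y
      calc |p q y| * |l q y| ≤ E y * (K * E y) := by
            gcongr
            · exact h1 y
            · exact h2 y
        _ = K * E y ^ 2 := by ring
        _ ≤ K * E y ^ 4 := by gcongr <;> norm_num
    · simpa using (hpt y).mul (hlt y)
  set c := ∫ z, l0 z ∂γ
  have hc : ∀ᶠ q in 𝓝[>] (0:ℝ), |∫ z, p q z * l q z ∂γ| < |c| + 1 :=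
    (hI1.abs).eventually_lt_const (by linarith)
  refine tendsto_integral_filter_of_dominated_convergence
    (fun y => (K + (|c| + 1)) ^ 3 * E y ^ 4) ?_ ?_ (hE.const_mul _) (ae_of_all _ fun y => ?_)
  · refine Eventually.of_forall fun q => Measurable.aestronglyMeasurable ?_
    have := hpm q
    have := hlm q
    exact (hpm q).mul ((((hlm q).sub_const _).abs).pow_const 3)
  · filter_upwards [hp, hl, hc] with q h1 h2 h3
    refine ae_of_all _ fun y => ?_
    rw [Real.norm_eq_abs, abs_mul, abs_pow, abs_abs]
    have hy := hE1 y
    have h4 : |l q y - ∫ z, p q z * l q z ∂γ| ≤ (K + (|c| + 1)) * E y := by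
      refine (abs_sub _ _).trans ?_
      have := h2 y
      nlinarith [abs_nonneg c]
    calc _ ≤ E y * ((K + (|c| + 1)) * E y) ^ 3 := by
          gcongr
          exact h1 y
      _ = _ := by ring
  · simpa using (hpt y).mul ((((hlt y).sub hI1).abs).pow 3)

lemma sgE_empty (σ : ℝ) (h : Finset ℕ → ℝ) (h0 : h ∅ = 0) (y : ℝ) : sgE σ h ∅ y = 1 := by
  simp [sgE, h0]

noncomputable def sgA (n : ℕ) (σ : ℝ) (h : Finset ℕ → ℝ) : ℝ :=
  ∑ J ∈ (Finset.range (n + 1)).powerset, |h J / σ ^ 2|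

lemma sgE_le (n : ℕ) (σ : ℝ) (h : Finset ℕ → ℝ) (J : Finset ℕ)
    (hJ : J ⊆ Finset.range (n + 1)) (y : ℝ) :
    sgE σ h J y ≤ Real.exp (sgA n σ h * |y|) := by
  unfold sgE
  apply Real.exp_le_exp.2
  have h1 : |h J / σ ^ 2| ≤ sgA n σ h :=
    Finset.single_le_sum (f := fun J => |h J / σ ^ 2|) (fun _ _ => abs_nonneg _)
      (Finset.mem_powerset.2 hJ)
  have h2 : 0 ≤ h J ^ 2 / (2 * σ ^ 2) := by positivity
  have h3 : h J / σ ^ 2 * y ≤ |h J / σ ^ 2| * |y| := by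
    rw [← abs_mul]; exact le_abs_self _
  have h4 := mul_le_mul_of_nonneg_right h1 (abs_nonneg y)
  linarith

lemma sgL_bounds (n : ℕ) (σ q : ℝ) (hq : 0 < q) (hq1 : q < 1) (h : Finset ℕ → ℝ) (y : ℝ) :
    let ρ := sgMix n q (fun J => sgE σ h (insert n J) y) / sgMix n q (fun J => sgE σ h J y)
    0 ≤ ρ ∧ sgL n σ h q y ≤ ρ - 1 ∧ (ρ - 1) / (1 + q * (ρ - 1)) ≤ sgL n σ h q y := by
  intro ρ
  have hQ := sgMix_pos n σ q hq.le hq1 h y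
  have hR := sgMix_nonneg n q hq.le hq1.le (fun J => sgE σ h (insert n J) y)
    fun J => (Real.exp_pos _).le
  have hρ : 0 ≤ ρ := div_nonneg hR hQ.le
  have hx : sgMix (n + 1) q (fun J => sgE σ h J y) / sgMix n q (fun J => sgE σ h J y)
      = 1 + q * (ρ - 1) := by
    rw [sgMix_succ]
    simp only [ρ]
    field_simp
    ring
  have hxp : 0 < 1 + q * (ρ - 1) := by nlinarith
  unfold sgL
  rw [hx]
  refine ⟨hρ, ?_, ?_⟩
  · rw [div_le_iff₀ hq]
    linarith [Real.log_le_sub_one_of_pos hxp]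
  · rw [le_div_iff₀ hq]
    have := Real.one_sub_inv_le_log_of_pos hxp
    refine le_trans (le_of_eq ?_) this
    rw [eq_sub_iff_add_eq, div_mul_eq_mul_div, ← one_div, ← add_div, div_eq_one_iff_eq hxp.ne']
    ring

lemma sgL_abs (n : ℕ) (σ q : ℝ) (hq : 0 < q) (hq1 : q ≤ 1 / 2) (h : Finset ℕ → ℝ)
    (h0 : h ∅ = 0) (y : ℝ) :
    |sgL n σ h q y| ≤ (2 ^ n + 2) * Real.exp (sgA n σ h * |y|) := by
  obtain ⟨h1, h2, h3⟩ := sgL_bounds n σ q hq (by linarith) h y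
  set ρ := sgMix n q (fun J => sgE σ h (insert n J) y) / sgMix n q (fun J => sgE σ h J y) with hρ
  have hA : 0 ≤ sgA n σ h := Finset.sum_nonneg fun _ _ => abs_nonneg _
  have hE : 1 ≤ Real.exp (sgA n σ h * |y|) := Real.one_le_exp (by positivity)
  set E := Real.exp (sgA n σ h * |y|)
  have hR : sgMix n q (fun J => sgE σ h (insert n J) y) ≤ E :=
    sgMix_le n q hq.le (by linarith) E _ fun J hJ => sgE_le n σ h _ (by
      rw [Finset.range_add_one]; exact Finset.insert_subset_insert _ hJ) y
  have hQ : (1 / 2 : ℝ) ^ n ≤ sgMix n q (fun J => sgE σ h J y) := by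
    have := le_sgMix n q hq.le (by linarith) (fun J => sgE σ h J y) fun J => (Real.exp_pos _).le
    simp only [sgE_empty σ h h0 y, mul_one] at this
    refine le_trans ?_ this
    gcongr
    linarith
  have hρE : ρ ≤ 2 ^ n * E := by
    rw [hρ, div_le_iff₀ (lt_of_lt_of_le (by positivity) hQ)]
    have h5 : (2:ℝ) ^ n * (1 / 2) ^ n = 1 := by rw [← mul_pow]; norm_num
    calc _ ≤ E := hR
      _ = 2 ^ n * E * (1 / 2) ^ n := by rw [mul_right_comm, h5, one_mul]
      _ ≤ _ := by gcongr
  have hlow : -2 ≤ sgL n σ h q y := by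
    refine le_trans ?_ h3
    rw [le_div_iff₀ (by nlinarith)]
    nlinarith
  rw [abs_le]
  have : (0:ℝ) ≤ 2 ^ n := by positivity
  constructor <;> nlinarith

lemma sgL_tendsto (n : ℕ) (σ : ℝ) (h : Finset ℕ → ℝ) (h0 : h ∅ = 0) (y : ℝ) :
    Tendsto (fun q => sgL n σ h q y) (𝓝[>] 0) (𝓝 (sgE σ h {n} y - 1)) := by
  have hρ : Tendsto (fun q => sgMix n q (fun J => sgE σ h (insert n J) y) /
      sgMix n q (fun J => sgE σ h J y)) (𝓝[>] 0) (𝓝 (sgE σ h {n} y)) := by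
    have h1 := ((sgMix_continuous n (fun J => sgE σ h (insert n J) y)).tendsto 0).mono_left
      (nhdsWithin_le_nhds (s := Set.Ioi 0))
    have h2 := ((sgMix_continuous n (fun J => sgE σ h J y)).tendsto 0).mono_left
      (nhdsWithin_le_nhds (s := Set.Ioi 0))
    rw [sgMix_zero] at h1 h2
    have := h1.div h2 (by rw [sgE_empty σ h h0 y]; norm_num)
    simp only [sgE_empty σ h h0 y, div_one] at this
    exact this
  have hid : Tendsto (fun q : ℝ => q) (𝓝[>] 0) (𝓝 0) := nhdsWithin_le_nhds
  have hub := hρ.sub_const 1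
  have hlb := hub.div ((hid.mul hub).const_add 1) (by simp)
  simp only [zero_mul, add_zero, div_one] at hlb
  have hev : ∀ᶠ q in 𝓝[>] (0:ℝ), q ∈ Set.Ioo (0:ℝ) 1 := Ioo_mem_nhdsGT one_pos
  refine tendsto_of_tendsto_of_tendsto_of_le_of_le' hlb hub ?_ ?_
  · filter_upwards [hev] with q hq
    exact (sgL_bounds n σ q hq.1 hq.2 h y).2.2
  · filter_upwards [hev] with q hq
    exact (sgL_bounds n σ q hq.1 hq.2 h y).2.1

lemma sgE_moment (σ : ℝ) (hσ : 0 < σ) (h : Finset ℕ → ℝ) (J : Finset ℕ) (k : ℕ) :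
    Integrable (fun y => sgE σ h J y ^ k) (gaussianReal 0 (σ ^ 2).toNNReal) ∧
    ∫ y, sgE σ h J y ^ k ∂(gaussianReal 0 (σ ^ 2).toNNReal) =
      Real.exp (((k:ℝ) ^ 2 - k) / 2 * (h J ^ 2 / σ ^ 2)) := by
  have he : ∀ y, sgE σ h J y ^ k =
      Real.exp (-(k * (h J ^ 2 / (2 * σ ^ 2)))) * Real.exp ((k * (h J / σ ^ 2)) * y) := by
    intro y
    rw [sgE, ← Real.exp_nat_mul, ← Real.exp_add]
    congr 1; ring
  simp only [he]
  refine ⟨(integrable_exp_mul_gaussianReal _).const_mul _, ?_⟩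
  rw [integral_const_mul]
  have hm := congrFun (mgf_id_gaussianReal (μ := 0) (v := (σ ^ 2).toNNReal)) (k * (h J / σ ^ 2))
  simp only [mgf, id] at hm
  rw [hm, ← Real.exp_add, Real.coe_toNNReal _ (by positivity)]
  congr 1
  field_simp
  ring

lemma sg_lt (σ : ℝ) (hσ : 0 < σ) (h : Finset ℕ → ℝ) (J : Finset ℕ) :
    ∫ y, |(sgE σ h J y - 1) - ∫ z, (sgE σ h J z - 1) ∂(gaussianReal 0 (σ ^ 2).toNNReal)| ^ 3
      ∂(gaussianReal 0 (σ ^ 2).toNNReal) <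
    Real.exp (3 * h J ^ 2 / σ ^ 2) + 3 * Real.exp (h J ^ 2 / σ ^ 2) + 1 := by
  obtain ⟨i1, e1⟩ := sgE_moment σ hσ h J 1
  obtain ⟨i2, e2⟩ := sgE_moment σ hσ h J 2
  obtain ⟨i3, e3⟩ := sgE_moment σ hσ h J 3
  simp only [pow_one] at i1 e1
  norm_num at e1 e2 e3
  have hz : ∫ z, (sgE σ h J z - 1) ∂(gaussianReal 0 (σ ^ 2).toNNReal) = 0 := by
    rw [integral_sub i1 (integrable_const _), e1]; simp
  rw [hz]
  simp only [sub_zero]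
  have hb : ∫ y, |sgE σ h J y - 1| ^ 3 ∂(gaussianReal 0 (σ ^ 2).toNNReal) ≤
      ∫ y, (sgE σ h J y ^ 3 + 3 * sgE σ h J y ^ 2 + (1 - 3 * sgE σ h J y))
        ∂(gaussianReal 0 (σ ^ 2).toNNReal) := by
    refine integral_mono_of_nonneg (ae_of_all _ fun y => by positivity)
      ((i3.add (i2.const_mul 3)).add ((integrable_const _).sub (i1.const_mul 3)))
      (ae_of_all _ fun y => ?_)
    have hr : 0 < sgE σ h J y := Real.exp_pos _
    simp only
    generalize sgE σ h J y = r at hr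
    rcases le_total 1 r with h1 | h1
    · rw [abs_of_nonneg (by linarith)]; nlinarith
    · rw [abs_of_nonpos (by linarith)]; nlinarith [pow_pos hr 3]
  have hv : ∫ y, (sgE σ h J y ^ 3 + 3 * sgE σ h J y ^ 2 + (1 - 3 * sgE σ h J y))
        ∂(gaussianReal 0 (σ ^ 2).toNNReal) = Real.exp (3 * h J ^ 2 / σ ^ 2) +
        3 * Real.exp (h J ^ 2 / σ ^ 2) + (1 - 3) := by
    have j1 : Integrable (fun y => sgE σ h J y ^ 3 + 3 * sgE σ h J y ^ 2)
      (gaussianReal 0 (σ ^ 2).toNNReal) := i3.add (i2.const_mul 3)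
    have j2 : Integrable (fun y => 1 - 3 * sgE σ h J y)
      (gaussianReal 0 (σ ^ 2).toNNReal) := (integrable_const _).sub (i1.const_mul 3)
    rw [integral_add j1 j2,
      integral_add i3 (i2.const_mul 3), integral_sub (integrable_const _) (i1.const_mul 3),
      integral_const_mul, integral_const_mul, e1, e2, e3]
    simp [mul_div_assoc]
  linarith

lemma sg_eventually (n m : ℕ) (hm : m ≤ n + 1) (σ : ℝ) (hσ : 0 < σ) (h : Finset ℕ → ℝ)
    (h0 : h ∅ = 0) : ∀ᶠ q in 𝓝[>] (0:ℝ),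
    (∫ y, |privacyLoss n σ q h y -
      ∫ z, privacyLoss n σ q h z ∂(subsampledQ m σ q h)| ^ 3 ∂(subsampledQ m σ q h)) ≤
    q ^ 3 * (Real.exp (3 * (h {n}) ^ 2 / σ ^ 2) + 3 * Real.exp ((h {n}) ^ 2 / σ ^ 2) + 1) := by
  have hA : 0 ≤ sgA n σ h := Finset.sum_nonneg fun _ _ => abs_nonneg _
  have hev : ∀ᶠ q in 𝓝[>] (0:ℝ), q ∈ Set.Ioo (0:ℝ) (1 / 2) := Ioo_mem_nhdsGT (by norm_num)
  have key := sgLim (γ := gaussianReal 0 (σ ^ 2).toNNReal)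
    (fun q y => sgMix m q (fun J => sgE σ h J y)) (sgL n σ h)
    (fun y => Real.exp (sgA n σ h * |y|)) (fun y => sgE σ h {n} y - 1) (2 ^ n + 2)
    (fun y => Real.one_le_exp (by positivity))
    (by
      have := integrable_exp_mul_abs (X := id) (t := 4 * sgA n σ h)
        (integrable_exp_mul_gaussianReal (μ := 0) (v := (σ ^ 2).toNNReal) _)
        (integrable_exp_mul_gaussianReal _)
      refine this.congr (ae_of_all _ fun y => ?_)
      simp only [id]
      rw [← Real.exp_nat_mul]; congr 1; push_cast; ring)
    (by positivity) (fun q => sgMix_meas m σ q h)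
    (fun q => by
      unfold sgL
      exact (((sgMix_meas (n + 1) σ q h).div (sgMix_meas n σ q h)).log).div_const q)
    (by
      filter_upwards [hev] with q hq y
      rw [abs_of_pos (sgMix_pos m σ q hq.1.le (by linarith [hq.2]) h y)]
      exact sgMix_le m q hq.1.le (by linarith [hq.2]) _ _ fun J hJ =>
        sgE_le n σ h J (hJ.trans (Finset.range_mono hm)) y)
    (by
      filter_upwards [hev] with q hq y
      exact sgL_abs n σ q hq.1 hq.2.le h h0 y)
    (fun y => by
      have h2 := ((sgMix_continuous m (fun J => sgE σ h J y)).tendsto 0).mono_left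
        (nhdsWithin_le_nhds (s := Set.Ioi 0))
      rwa [sgMix_zero, sgE_empty σ h h0 y] at h2)
    (fun y => sgL_tendsto n σ h h0 y)
  filter_upwards [hev, key.eventually_lt_const (sg_lt σ hσ h {n})] with q hq hlt
  rw [moment_eq n m σ q hσ hq.1 (by linarith [hq.2]) h]
  exact mul_le_mul_of_nonneg_left hlt.le (pow_nonneg hq.1.le 3)

/-- **Small sampling-rate bound on the third absolute central moment of the privacy
loss of the Poisson-subsampled Gaussian mechanism.**  With `μ = |h {n}|`, as `q → 0`:
`E_{P_q}|L_q − E_{P_q} L_q|³ ≤ q³ (e^{3μ²/σ²} + 3 e^{μ²/σ²} + 1) + O(q⁴)` and likewise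
under `Q_q`. -/
theorem subsampledGaussian_third_moment_privacyLoss_small_q
    (n : ℕ) (σ : ℝ) (hσ : 0 < σ) (h : Finset ℕ → ℝ) (h0 : h ∅ = 0) :
    ∃ C > (0 : ℝ), ∃ q₀ ∈ Set.Ioo (0 : ℝ) 1, ∀ q ∈ Set.Ioc (0 : ℝ) q₀,
      (∫ y, |privacyLoss n σ q h y -
            ∫ z, privacyLoss n σ q h z ∂(subsampledP n σ q h)| ^ 3
          ∂(subsampledP n σ q h))
        ≤ q ^ 3 * (Real.exp (3 * (h {n}) ^ 2 / σ ^ 2) +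
            3 * Real.exp ((h {n}) ^ 2 / σ ^ 2) + 1) + C * q ^ 4 ∧
      (∫ y, |privacyLoss n σ q h y -
            ∫ z, privacyLoss n σ q h z ∂(subsampledQ n σ q h)| ^ 3
          ∂(subsampledQ n σ q h))
        ≤ q ^ 3 * (Real.exp (3 * (h {n}) ^ 2 / σ ^ 2) +
            3 * Real.exp ((h {n}) ^ 2 / σ ^ 2) + 1) + C * q ^ 4 := by
  have hP := sg_eventually n (n + 1) le_rfl σ hσ h h0
  have hQ := sg_eventually n n (Nat.le_succ n) σ hσ h h0
  obtain ⟨u, hu, hsub⟩ := mem_nhdsGT_iff_exists_Ioc_subset.1 (hP.and hQ)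
  have hu : 0 < u := hu
  refine ⟨1, one_pos, min u (1 / 2), ⟨by positivity,
    lt_of_le_of_lt (min_le_right _ _) (by norm_num)⟩, fun q hq => ?_⟩
  have hq4 : 0 ≤ 1 * q ^ 4 := by have := hq.1; positivity
  obtain ⟨a, b⟩ := hsub ⟨hq.1, hq.2.trans (min_le_left _ _)⟩
  rw [subP_eq]
  exact ⟨a.trans (le_add_of_nonneg_right hq4), b.trans (le_add_of_nonneg_right hq4)⟩
end
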